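/- Let I=(V,E,c,D) be an instance of the min-congestion multi-commodity unsplittable flow problem whose minimum capacity is 1, let α > 0, let I'=(V',E',ℰ',c',D') be the MCRN instance constructed from I and α as described, and let M* = { {v_i, v_{i'}} : v_i ∈ V }. Then M* is a matching, and for every real λ ≥ 1: there exists an unsplittable segregated flow serving D' in N(M*) with congestion at most λ if and only if there exists an unsplittable flow serving D in (V,E,c) with congestion at most λ. -/

import Mathlib

open Finset

namespace MCRN

/-- A directed link of a reconfigurable network: either a direction of a bidirected
static link (indexed by `E × Bool`) or a directed reconfigurable link `(i, j)`. -/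
abbrev SLink (V E : Type*) := (E × Bool) ⊕ (V × V)

variable {V E : Type*}

/-- Tail of a directed link. -/
def tl (src tgt : E → V) : SLink V E → V
  | .inl (e, b) => if b then src e else tgt e
  | .inr (i, _) => i

/-- Head of a directed link. -/
def hd (src tgt : E → V) : SLink V E → V
  | .inl (e, b) => if b then tgt e else src e
  | .inr (_, j) => j

variable [Fintype V] [DecidableEq V] [Fintype E] [DecidableEq E]

/-- Net outflow of `g` at node `v`. -/
def netOut (src tgt : E → V) (g : SLink V E → ℝ) (v : V) : ℝ :=
  (∑ a : SLink V E, if tl src tgt a = v then g a else 0)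
    - ∑ a : SLink V E, if hd src tgt a = v then g a else 0

/-- A matching: a set of non-diagonal unordered pairs, no two sharing an endpoint. -/
def IsMatching (M : Finset (Sym2 V)) : Prop :=
  (∀ p ∈ M, ¬ p.IsDiag) ∧ ∀ p ∈ M, ∀ q ∈ M, ∀ v : V, v ∈ p → v ∈ q → p = q

/-- A splittable flow serving demands `D` in the reconfigured network `N(M)`:
nonnegative, supported on static links and reconfigurable links of `M`,
conserved away from endpoints, and sending net flow `D i j` from `i` to `j`. -/
structure IsFlow (src tgt : E → V) (D : V → V → ℝ) (M : Finset (Sym2 V))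
    (f : V → V → SLink V E → ℝ) : Prop where
  nonneg : ∀ i j a, 0 ≤ f i j a
  supp : ∀ i j p q, s(p, q) ∉ M → f i j (Sum.inr (p, q)) = 0
  diag : ∀ i a, f i i a = 0
  conserve : ∀ i j v, v ≠ i → v ≠ j → netOut src tgt (f i j) v = 0
  demand : ∀ i j, i ≠ j → netOut src tgt (f i j) i = D i j

/-- A flow is segregated if each positive demand is carried either entirely by the
single directed reconfigurable link `(i, j)` or only by directed static links. -/
def Segregated (D : V → V → ℝ) (f : V → V → SLink V E → ℝ) : Prop :=
  ∀ i j, 0 < D i j →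
    (∀ a : SLink V E, a ≠ Sum.inr (i, j) → f i j a = 0) ∨
    ∀ p q : V, f i j (Sum.inr (p, q)) = 0

/-- Total flow on a directed link. -/
def totalFlow (f : V → V → SLink V E → ℝ) (a : SLink V E) : ℝ := ∑ i, ∑ j, f i j a

/-- The congestion (maximum load) of the flow `f` in `N(M)` is at most `lam`. -/
def CongLE (c : SLink V E → ℝ) (M : Finset (Sym2 V)) (f : V → V → SLink V E → ℝ)
    (lam : ℝ) : Prop :=
  (∀ (e : E) (b : Bool), totalFlow f (Sum.inl (e, b)) ≤ lam * c (Sum.inl (e, b))) ∧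
  ∀ p q : V, s(p, q) ∈ M → totalFlow f (Sum.inr (p, q)) ≤ lam * c (Sum.inr (p, q))

/-- The congestion (maximum load) of the flow `f` in `N(M)` is at least `lam`:
some existing directed link has load at least `lam`. -/
def CongGE (c : SLink V E → ℝ) (M : Finset (Sym2 V)) (f : V → V → SLink V E → ℝ)
    (lam : ℝ) : Prop :=
  (∃ (e : E) (b : Bool), lam * c (Sum.inl (e, b)) ≤ totalFlow f (Sum.inl (e, b))) ∨
  ∃ p q : V, s(p, q) ∈ M ∧ lam * c (Sum.inr (p, q)) ≤ totalFlow f (Sum.inr (p, q))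

/-- A (nonempty, repetition-free) directed path from `i` to `j`. -/
def IsDiPath (src tgt : E → V) (i j : V) (P : List (SLink V E)) : Prop :=
  P ≠ [] ∧ P.Nodup ∧ P.Chain' (fun a b => hd src tgt a = tl src tgt b) ∧
    P.head?.map (tl src tgt) = some i ∧ P.getLast?.map (hd src tgt) = some j

/-- The flow is unsplittable: each positive demand is routed along a single directed path. -/
def Unsplittable (src tgt : E → V) (D : V → V → ℝ) (f : V → V → SLink V E → ℝ) : Prop :=
  ∀ i j, 0 < D i j → ∃ P : List (SLink V E), IsDiPath src tgt i j P ∧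
    (∀ a ∈ P, f i j a = D i j) ∧ ∀ a : SLink V E, a ∉ P → f i j a = 0

end MCRN

namespace MCRN
namespace Red

/-- Static links of the constructed instance: the original links `E` together with one
new link `{v_i, v_i'}` for each original node. -/
def src2 {V E : Type*} (src : E → V) : E ⊕ V → V ⊕ V
  | .inl e => .inl (src e)
  | .inr v => .inl v

def tgt2 {V E : Type*} (tgt : E → V) : E ⊕ V → V ⊕ V
  | .inl e => .inl (tgt e)
  | .inr v => .inr v

/-- Capacities of the constructed instance: original static links keep their
capacities, the new static links `{v_i, v_i'}` have capacity `1` both ways, the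
reconfigurable direction `(v_i, v_i')` has capacity `α`, and every other
reconfigurable directed link has capacity `1`. -/
noncomputable def cap2 {V E : Type*} [DecidableEq V] (c : E → Bool → ℝ) (α : ℝ) :
    SLink (V ⊕ V) (E ⊕ V) → ℝ
  | .inl (.inl e, b) => c e b
  | .inl (.inr _, _) => 1
  | .inr (.inl v, .inr w) => if v = w then α else 1
  | .inr _ => 1

/-- Demands of the constructed instance: the original demands `D` together with a
demand `α` from `v_i` to `v_i'` for every original node. -/
noncomputable def D2 {V : Type*} [DecidableEq V] (D : V → V → ℝ) (α : ℝ) :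
    V ⊕ V → V ⊕ V → ℝ
  | .inl i, .inl j => D i j
  | .inl i, .inr j => if i = j then α else 0
  | _, _ => 0

/-- Capacities of the base instance, seen as a reconfigurable network with the empty
reconfiguration (reconfigurable capacities are irrelevant). -/
noncomputable def capBase {V E : Type*} (c : E → Bool → ℝ) : SLink V E → ℝ
  | .inl (e, b) => c e b
  | .inr _ => 1

end Red
end MCRN

namespace MCRN
open Red

/-- A directed walk from `i` to `j`, given by its list of links. -/
def IsDiWalk {V E : Type*} (src tgt : E → V) : V → List (SLink V E) → V → Prop
  | i, [], j => i = j
  | i, a :: P, j => tl src tgt a = i ∧ IsDiWalk src tgt (hd src tgt a) P j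

lemma isDiWalk_cons_iff {V E : Type*} (src tgt : E → V) (i j : V) (a : SLink V E)
    (P : List (SLink V E)) :
    IsDiWalk src tgt i (a :: P) j ↔
      (a :: P).Chain' (fun a b => hd src tgt a = tl src tgt b) ∧
        tl src tgt a = i ∧ (a :: P).getLast?.map (hd src tgt) = some j := by
  induction P generalizing a i with
  | nil => simp [IsDiWalk, List.Chain']
  | cons b P ih =>
    rw [IsDiWalk, ih]
    simp only [List.Chain', List.isChain_cons_cons, List.getLast?_cons_cons]
    grind

lemma isDiPath_iff {V E : Type*} (src tgt : E → V) (i j : V) (P : List (SLink V E)) :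
    IsDiPath src tgt i j P ↔ P ≠ [] ∧ P.Nodup ∧ IsDiWalk src tgt i P j := by
  cases P with
  | nil => simp [IsDiPath]
  | cons a P => rw [isDiWalk_cons_iff]; simp [IsDiPath]

/-- The node of the original network underlying a node of the constructed one. -/
def nodeProj {V : Type*} : V ⊕ V → V := Sum.elim id id

/-- The original static link underlying a link of the constructed network, if any. -/
def linkProj {V E : Type*} : SLink (V ⊕ V) (E ⊕ V) → Option (SLink V E)
  | .inl (.inl e, b) => some (.inl (e, b))
  | _ => none

/-- The inclusion of the original static links into the constructed network. -/
def linkIncl {V E : Type*} (a : E × Bool) : SLink (V ⊕ V) (E ⊕ V) := .inl (.inl a.1, a.2)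

/-- The restriction of a link function of the constructed network to the original one. -/
def restrictFlow {V E : Type*} (h : SLink (V ⊕ V) (E ⊕ V) → ℝ) : SLink V E → ℝ
  | .inl a => h (linkIncl a)
  | .inr _ => 0

/-- The extension by zero of a link function to the constructed network. -/
def extendFlow {V E : Type*} (h : SLink V E → ℝ) : SLink (V ⊕ V) (E ⊕ V) → ℝ
  | .inl (.inl e, b) => h (.inl (e, b))
  | _ => 0

/-- The unordered pairs formed by an original node and its copy. -/
abbrev pairing (V : Type*) [Fintype V] [DecidableEq V] : Finset (Sym2 (V ⊕ V)) :=
  Finset.univ.image fun v : V => s((Sum.inl v : V ⊕ V), Sum.inr v)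

lemma nodeProj_eq_of_mem_pairing {V : Type*} [Fintype V] [DecidableEq V] {p q : V ⊕ V}
    (h : s(p, q) ∈ pairing V) : nodeProj p = nodeProj q := by
  simp only [pairing, Finset.mem_image, Finset.mem_univ, true_and, Sym2.eq_iff] at h
  obtain ⟨v, ⟨rfl, rfl⟩ | ⟨rfl, rfl⟩⟩ := h <;> rfl

lemma ite_nodeProj_eq {V : Type*} [DecidableEq V] (x : V ⊕ V) (v : V) (r : ℝ) :
    (if nodeProj x = v then r else 0) =
      (if x = .inl v then r else 0) + if x = .inr v then r else 0 := by
  rcases x with x | x <;> by_cases h : x = v <;> simp [nodeProj, h]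

lemma isMatching_pairing (V : Type*) [Fintype V] [DecidableEq V] :
    IsMatching (pairing V) := by
  refine ⟨?_, ?_⟩
  · simp [pairing]
  · simp only [pairing, Finset.mem_image, Finset.mem_univ, true_and]
    rintro _ ⟨a, rfl⟩ _ ⟨b, rfl⟩ v h₁ h₂
    rw [Sym2.mem_iff] at h₁ h₂
    grind

lemma IsDiWalk.filterMap_linkProj {V E : Type*} [Fintype V] [DecidableEq V]
    {src tgt : E → V} {x y : V ⊕ V} {P : List (SLink (V ⊕ V) (E ⊕ V))}
    (hP : IsDiWalk (src2 src) (tgt2 tgt) x P y)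
    (hM : ∀ p q, Sum.inr (p, q) ∈ P → s(p, q) ∈ pairing V) :
    IsDiWalk src tgt (nodeProj x) (P.filterMap linkProj) (nodeProj y) := by
  induction P generalizing x with
  | nil => exact congrArg nodeProj hP
  | cons a P ih =>
    obtain ⟨rfl, hP⟩ := hP
    have key := ih hP fun p q h => hM p q (List.mem_cons_of_mem _ h)
    rcases a with ⟨e | v, b⟩ | ⟨p, q⟩
    · cases b <;> exact ⟨rfl, key⟩
    · cases b <;> exact key
    · have := nodeProj_eq_of_mem_pairing (hM p q List.mem_cons_self)
      change IsDiWalk src tgt (nodeProj p) (P.filterMap linkProj) _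
      rw [this]
      exact key

lemma linkProj_eq_some_iff {V E : Type*} {a : SLink (V ⊕ V) (E ⊕ V)} {b : SLink V E} :
    linkProj a = some b ↔ ∃ s, b = .inl s ∧ a = linkIncl s := by
  rcases a with ⟨e | v, b'⟩ | ⟨p, q⟩ <;> simp [linkProj, linkIncl, eq_comm]

lemma inl_mem_filterMap_linkProj {V E : Type*} {P : List (SLink (V ⊕ V) (E ⊕ V))}
    {s : E × Bool} :
    (Sum.inl s : SLink V E) ∈ P.filterMap linkProj ↔ linkIncl s ∈ P := by
  simp only [List.mem_filterMap, linkProj_eq_some_iff]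
  grind

lemma netOut_restrictFlow {V E : Type*} [Fintype V] [DecidableEq V] [Fintype E]
    (src tgt : E → V) {h : SLink (V ⊕ V) (E ⊕ V) → ℝ}
    (hM : ∀ p q, s(p, q) ∉ pairing V → h (.inr (p, q)) = 0) (v : V) :
    netOut src tgt (restrictFlow h) v =
      netOut (src2 src) (tgt2 tgt) h (.inl v) + netOut (src2 src) (tgt2 tgt) h (.inr v) := by
  have key : netOut (src2 src) (tgt2 tgt) h (.inl v) + netOut (src2 src) (tgt2 tgt) h (.inr v) =
      ∑ a, ((if nodeProj (tl (src2 src) (tgt2 tgt) a) = v then h a else 0) -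
        if nodeProj (hd (src2 src) (tgt2 tgt) a) = v then h a else 0) := by
    simp only [netOut, ← Finset.sum_sub_distrib, ← Finset.sum_add_distrib]
    refine Finset.sum_congr rfl fun a _ => ?_
    linarith [ite_nodeProj_eq (tl (src2 src) (tgt2 tgt) a) v (h a),
      ite_nodeProj_eq (hd (src2 src) (tgt2 tgt) a) v (h a)]
  rw [key, netOut, ← Finset.sum_sub_distrib]
  simp only [Fintype.sum_sum_type (α₁ := (_ × Bool)), Fintype.sum_prod_type (α₁ := E),
    Fintype.sum_prod_type (α₁ := E ⊕ V), Fintype.sum_sum_type (α₁ := E)]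
  have h₁ : ∑ a : (V ⊕ V) × (V ⊕ V),
      ((if nodeProj (tl (src2 src) (tgt2 tgt) (.inr a)) = v then h (.inr a) else 0) -
        if nodeProj (hd (src2 src) (tgt2 tgt) (.inr a)) = v then h (.inr a) else 0) = 0 := by
    refine Finset.sum_eq_zero fun ⟨p, q⟩ _ => ?_
    by_cases hpq : s(p, q) ∈ pairing V
    · have : nodeProj (tl (src2 src) (tgt2 tgt) (.inr (p, q))) =
          nodeProj (hd (src2 src) (tgt2 tgt) (.inr (p, q))) := nodeProj_eq_of_mem_pairing hpq
      simp [this]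
    · simp [hM p q hpq]
  rw [h₁]
  simp only [restrictFlow, ite_self]
  simp [tl, hd, src2, tgt2, nodeProj, linkIncl]

lemma netOut_extendFlow_inl {V E : Type*} [Fintype V] [DecidableEq V] [Fintype E]
    (src tgt : E → V) {h : SLink V E → ℝ} (hh : ∀ p q, h (.inr (p, q)) = 0) (v : V) :
    netOut (src2 src) (tgt2 tgt) (extendFlow h) (.inl v) = netOut src tgt h v := by
  simp only [netOut, Fintype.sum_sum_type (α₁ := (_ × Bool)), Fintype.sum_prod_type (α₁ := E),
    Fintype.sum_prod_type (α₁ := E ⊕ V), Fintype.sum_sum_type (α₁ := E)]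
  simp only [extendFlow, hh, ite_self, Finset.sum_const_zero]
  simp [tl, hd, src2, tgt2]

lemma netOut_extendFlow_inr {V E : Type*} [Fintype V] [DecidableEq V] [Fintype E]
    (src tgt : E → V) (h : SLink V E → ℝ) (v : V) :
    netOut (src2 src) (tgt2 tgt) (extendFlow h) (.inr v) = 0 := by
  simp only [netOut, Fintype.sum_sum_type (α₁ := (_ × Bool)),
    Fintype.sum_prod_type (α₁ := E ⊕ V), Fintype.sum_sum_type (α₁ := E)]
  simp only [extendFlow, ite_self, Finset.sum_const_zero]
  simp [tl, hd, src2, tgt2]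

lemma netOut_zero {V E : Type*} [Fintype V] [DecidableEq V] [Fintype E]
    (src tgt : E → V) (v : V) : netOut src tgt 0 v = 0 := by
  simp [netOut]

lemma netOut_single {V E : Type*} [Fintype V] [DecidableEq V] [Fintype E] [DecidableEq E]
    (src tgt : E → V) (a : SLink V E) (x : ℝ) (v : V) :
    netOut src tgt (Pi.single a x) v =
      (if tl src tgt a = v then x else 0) - if hd src tgt a = v then x else 0 := by
  simp only [netOut]
  rw [Finset.sum_eq_single a, Finset.sum_eq_single a] <;> simp +contextual

/-- The flow of the constructed network which extends `g` and sends `α` units from each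
original node to its copy along the reconfigurable link. -/
noncomputable def liftFlow {V E : Type*} [DecidableEq V] [DecidableEq E]
    (g : V → V → SLink V E → ℝ) (α : ℝ) :
    V ⊕ V → V ⊕ V → SLink (V ⊕ V) (E ⊕ V) → ℝ
  | .inl i, .inl j => extendFlow (g i j)
  | .inl i, .inr j => if i = j then Pi.single (.inr (.inl i, .inr j)) α else 0
  | .inr _, _ => 0

lemma isFlow_restrictFlow {V E : Type*} [Fintype V] [DecidableEq V] [Fintype E]
    {src tgt : E → V} {D : V → V → ℝ} {α : ℝ}
    {f : (V ⊕ V) → (V ⊕ V) → SLink (V ⊕ V) (E ⊕ V) → ℝ}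
    (hf : IsFlow (src2 src) (tgt2 tgt) (D2 D α) (pairing V) f) :
    IsFlow src tgt D ∅ fun i j => restrictFlow (f (.inl i) (.inl j)) where
  nonneg i j a := by
    rcases a with a | a
    · exact hf.nonneg _ _ _
    · exact le_rfl
  supp _ _ _ _ _ := rfl
  diag i a := by
    rcases a with a | a
    · exact hf.diag _ _
    · rfl
  conserve i j v hi hj := by
    rw [netOut_restrictFlow src tgt (hf.supp _ _), hf.conserve _ _ _ (by simpa) (by simpa),
      hf.conserve _ _ _ (by simp) (by simp), add_zero]
  demand i j hij := by
    rw [netOut_restrictFlow src tgt (hf.supp _ _), hf.demand _ _ (by simpa),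
      hf.conserve _ _ _ (by simp) (by simp), add_zero]
    rfl

lemma unsplittable_restrictFlow {V E : Type*} [Fintype V] [DecidableEq V] [Fintype E]
    {src tgt : E → V} {D : V → V → ℝ} (hDdiag : ∀ i, D i i = 0) {α : ℝ}
    {f : (V ⊕ V) → (V ⊕ V) → SLink (V ⊕ V) (E ⊕ V) → ℝ}
    (hf : IsFlow (src2 src) (tgt2 tgt) (D2 D α) (pairing V) f)
    (hu : Unsplittable (src2 src) (tgt2 tgt) (D2 D α) f) :
    Unsplittable src tgt D fun i j => restrictFlow (f (.inl i) (.inl j)) := by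
  intro i j hij
  obtain ⟨P, hP, hon, hoff⟩ := hu (.inl i) (.inl j) hij
  obtain ⟨-, hnd, hw⟩ := (isDiPath_iff ..).1 hP
  have hM : ∀ p q, Sum.inr (p, q) ∈ P → s(p, q) ∈ pairing V := by
    intro p q hpq
    by_contra hn
    exact hij.ne' ((hon _ hpq).symm.trans (hf.supp _ _ _ _ hn))
  have hw' := hw.filterMap_linkProj hM
  refine ⟨P.filterMap linkProj, (isDiPath_iff ..).2 ⟨?_, ?_, hw'⟩, ?_, ?_⟩
  · intro h0
    rw [h0] at hw'
    have : i = j := hw'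
    subst this
    exact hij.ne' (hDdiag i)
  · refine hnd.filterMap fun a a' b hb hb' => ?_
    obtain ⟨s, rfl, rfl⟩ := linkProj_eq_some_iff.1 hb
    obtain ⟨s', hs, rfl⟩ := linkProj_eq_some_iff.1 hb'
    rw [Sum.inl.inj hs]
  · intro a ha
    obtain ⟨a', ha', h⟩ := List.mem_filterMap.1 ha
    obtain ⟨s, rfl, rfl⟩ := linkProj_eq_some_iff.1 h
    exact hon _ ha'
  · rintro (a | a) ha
    · exact hoff _ fun h => ha (inl_mem_filterMap_linkProj.2 h)
    · rfl

lemma congLE_restrictFlow {V E : Type*} [Fintype V] [DecidableEq V] [Fintype E]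
    {c : E → Bool → ℝ} {α lam : ℝ} {M : Finset (Sym2 (V ⊕ V))}
    {f : (V ⊕ V) → (V ⊕ V) → SLink (V ⊕ V) (E ⊕ V) → ℝ}
    (hf : ∀ i j a, 0 ≤ f i j a) (hc : CongLE (cap2 c α) M f lam) :
    CongLE (capBase c) ∅ (fun i j => restrictFlow (f (.inl i) (.inl j))) lam := by
  refine ⟨fun e b => le_trans ?_ (hc.1 (.inl e) b), by simp⟩
  simp only [totalFlow, Fintype.sum_sum_type]
  refine le_add_of_le_of_nonneg (Finset.sum_le_sum fun i _ => ?_) ?_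
  · exact le_add_of_nonneg_right (Finset.sum_nonneg fun j _ => hf _ _ _)
  · exact Finset.sum_nonneg fun i _ => add_nonneg (Finset.sum_nonneg fun j _ => hf _ _ _)
      (Finset.sum_nonneg fun j _ => hf _ _ _)

lemma isFlow_liftFlow {V E : Type*} [Fintype V] [DecidableEq V] [Fintype E] [DecidableEq E]
    {src tgt : E → V} {D : V → V → ℝ} {α : ℝ} (hα : 0 ≤ α) {g : V → V → SLink V E → ℝ}
    (hg : IsFlow src tgt D ∅ g) :
    IsFlow (src2 src) (tgt2 tgt) (D2 D α) (pairing V) (liftFlow g α) where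
  nonneg i j a := by
    rcases i with i | i <;> rcases j with j | j
    · rcases a with ⟨e | v, b⟩ | a
      · exact hg.nonneg _ _ _
      all_goals exact le_rfl
    · simp only [liftFlow]
      split_ifs
      · exact (Pi.single_nonneg (α := fun _ => ℝ)).2 hα a
      · exact le_rfl
    all_goals exact le_rfl
  supp i j p q hpq := by
    rcases i with i | i <;> rcases j with j | j
    · rfl
    · simp only [liftFlow]
      split_ifs with hij
      · subst hij
        refine Pi.single_eq_of_ne ?_ _
        rintro h
        obtain ⟨rfl, rfl⟩ := Prod.mk.inj (Sum.inr.inj h)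
        exact hpq (Finset.mem_image_of_mem _ (Finset.mem_univ i))
      · rfl
    all_goals rfl
  diag i a := by
    rcases i with i | i
    · rcases a with ⟨e | v, b⟩ | a
      · exact hg.diag _ _
      all_goals rfl
    · rfl
  conserve i j v hi hj := by
    rcases i with i | i
    · rcases j with j | j
      · rcases v with v | v
        · exact (netOut_extendFlow_inl src tgt (fun p q => hg.supp i j p q (by simp)) v).trans
            (hg.conserve _ _ _ (by simpa using hi) (by simpa using hj))
        · exact netOut_extendFlow_inr src tgt _ v
      · simp only [liftFlow]
        split_ifs with hij
        · simp [netOut_single, tl, hd, hi.symm, hj.symm]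
        · exact netOut_zero _ _ _
    · exact netOut_zero _ _ _
  demand i j hij := by
    rcases i with i | i
    · rcases j with j | j
      · exact (netOut_extendFlow_inl src tgt (fun p q => hg.supp i j p q (by simp)) i).trans
          (hg.demand _ _ (by simpa using hij))
      · simp only [liftFlow, D2]
        split_ifs with h
        · simp [netOut_single, tl, hd]
        · exact netOut_zero _ _ _
    · exact netOut_zero _ _ _

/-- The inclusion of the links of the original network into the constructed one. -/
def linkMap {V E : Type*} : SLink V E → SLink (V ⊕ V) (E ⊕ V) :=
  Sum.map (Prod.map Sum.inl id) (Prod.map Sum.inl Sum.inl)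

lemma linkMap_injective {V E : Type*} :
    Function.Injective (linkMap : SLink V E → SLink (V ⊕ V) (E ⊕ V)) :=
  (Sum.inl_injective.prodMap Function.injective_id).sumMap
    (Sum.inl_injective.prodMap Sum.inl_injective)

lemma IsDiWalk.map_linkMap {V E : Type*} {src tgt : E → V} {x y : V} {P : List (SLink V E)}
    (hP : IsDiWalk src tgt x P y) :
    IsDiWalk (src2 src) (tgt2 tgt) (.inl x) (P.map linkMap) (.inl y) := by
  induction P generalizing x with
  | nil => exact congrArg Sum.inl hP
  | cons a P ih =>
    obtain ⟨rfl, hP⟩ := hP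
    rcases a with ⟨e, _ | _⟩ | ⟨p, q⟩ <;> exact ⟨rfl, ih hP⟩

lemma unsplittable_liftFlow {V E : Type*} [Fintype V] [DecidableEq V] [Fintype E]
    [DecidableEq E]
    {src tgt : E → V} {D : V → V → ℝ} {α : ℝ} {g : V → V → SLink V E → ℝ}
    (hg : IsFlow src tgt D ∅ g) (hu : Unsplittable src tgt D g) :
    Unsplittable (src2 src) (tgt2 tgt) (D2 D α) (liftFlow g α) := by
  rintro (i | i) (j | j) hij
  · obtain ⟨P, hP, hon, hoff⟩ := hu i j hij
    obtain ⟨hne, hnd, hw⟩ := (isDiPath_iff ..).1 hP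
    refine ⟨P.map linkMap, (isDiPath_iff ..).2
      ⟨by simpa using hne, hnd.map linkMap_injective, hw.map_linkMap⟩, ?_, ?_⟩
    · intro a ha
      obtain ⟨b, hb, rfl⟩ := List.mem_map.1 ha
      rcases b with ⟨e, b⟩ | ⟨p, q⟩
      · exact hon _ hb
      · exact (hg.supp i j p q (by simp)).symm.trans (hon _ hb)
    · rintro (⟨e | v, b⟩ | a) ha
      · exact hoff (.inl (e, b)) fun h => ha (List.mem_map_of_mem h)
      all_goals rfl
  · obtain rfl : i = j := by
      by_contra h
      simp [D2, h] at hij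
    refine ⟨[.inr (.inl i, .inr i)], (isDiPath_iff ..).2
      ⟨by simp, by simp, rfl, rfl⟩, ?_, ?_⟩
    · simp [liftFlow, D2]
    · intro a ha
      simp only [liftFlow, if_true]
      exact Pi.single_eq_of_ne (by simpa using ha) _
  all_goals exact absurd hij (lt_irrefl _)

lemma segregated_liftFlow {V E : Type*} [DecidableEq V] [DecidableEq E]
    (D : V → V → ℝ) (α : ℝ) (g : V → V → SLink V E → ℝ) :
    Segregated (D2 D α) (liftFlow g α) := by
  rintro (i | i) (j | j) hij
  · exact .inr fun p q => rfl
  · refine .inl fun a ha => ?_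
    simp only [liftFlow]
    split_ifs
    · exact Pi.single_eq_of_ne ha _
    · rfl
  all_goals exact .inr fun p q => rfl

lemma totalFlow_liftFlow {V E : Type*} [Fintype V] [DecidableEq V] [DecidableEq E]
    (g : V → V → SLink V E → ℝ) (α : ℝ) (a : SLink (V ⊕ V) (E ⊕ V)) :
    totalFlow (liftFlow g α) a =
      extendFlow (totalFlow g) a + ∑ i, Pi.single (M := fun _ => ℝ) (.inr (.inl i, .inr i)) α a := by
  have h (i : V) : ∑ j, liftFlow g α (.inl i) (.inr j) a =
      Pi.single (M := fun _ => ℝ) (.inr (.inl i, .inr i)) α a := by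
    rw [Finset.sum_eq_single i] <;> simp +contextual [liftFlow, eq_comm]
  have h' : ∑ i, ∑ j, extendFlow (g i j) a = extendFlow (totalFlow g) a := by
    rcases a with ⟨e | v, b⟩ | a <;> simp [extendFlow, totalFlow]
  simp only [totalFlow, Fintype.sum_sum_type, Finset.sum_add_distrib, h]
  simp [liftFlow, ← h']

lemma congLE_liftFlow {V E : Type*} [Fintype V] [DecidableEq V] [DecidableEq E]
    {c : E → Bool → ℝ} {α lam : ℝ} (hα : 0 ≤ α) (hlam : 1 ≤ lam) {g : V → V → SLink V E → ℝ}
    (hc : CongLE (capBase c) ∅ g lam) :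
    CongLE (cap2 c α) (pairing V) (liftFlow g α) lam := by
  refine ⟨?_, ?_⟩
  · rintro (e | v) b
    · simpa [totalFlow_liftFlow, extendFlow, cap2, capBase] using hc.1 e b
    · simp [totalFlow_liftFlow, extendFlow, cap2]
      linarith
  · intro p q hpq
    simp only [pairing, Finset.mem_image, Finset.mem_univ, true_and, Sym2.eq_iff] at hpq
    obtain ⟨v, ⟨rfl, rfl⟩ | ⟨rfl, rfl⟩⟩ := hpq
    · simp [totalFlow_liftFlow, extendFlow, cap2, Pi.single_apply]
      nlinarith
    · simp [totalFlow_liftFlow, extendFlow, cap2]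
      linarith

/-- in the constructed MCRN instance, the set
`M* = { {v_i, v_i'} : v_i ∈ V }` is a matching, and for every `λ ≥ 1` there is an
unsplittable segregated flow serving the demands in `N(M*)` with congestion at most
`λ` if and only if there is an unsplittable flow serving `D` in the original network
with congestion at most `λ`. -/
theorem reduction_equivalence
    {V E : Type*} [Fintype V] [DecidableEq V] [Fintype E] [DecidableEq E]
    (src tgt : E → V) (c : E → Bool → ℝ)
    (hc1 : ∀ e b, 1 ≤ c e b) (hcattain : ∃ e b, c e b = 1)
    (D : V → V → ℝ) (hD : ∀ i j, 0 ≤ D i j) (hDdiag : ∀ i, D i i = 0)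
    (α : ℝ) (hα : 0 < α)
    (lam : ℝ) (hlam : 1 ≤ lam) :
    IsMatching ((Finset.univ.image fun v : V => s((Sum.inl v : V ⊕ V), Sum.inr v)) :
        Finset (Sym2 (V ⊕ V))) ∧
    ((∃ f : (V ⊕ V) → (V ⊕ V) → SLink (V ⊕ V) (E ⊕ V) → ℝ,
        IsFlow (src2 src) (tgt2 tgt) (D2 D α)
          (Finset.univ.image fun v : V => s((Sum.inl v : V ⊕ V), Sum.inr v)) f ∧
        Unsplittable (src2 src) (tgt2 tgt) (D2 D α) f ∧
        Segregated (D2 D α) f ∧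
        CongLE (cap2 c α)
          (Finset.univ.image fun v : V => s((Sum.inl v : V ⊕ V), Sum.inr v)) f lam) ↔
      ∃ g : V → V → SLink V E → ℝ,
        IsFlow src tgt D (∅ : Finset (Sym2 V)) g ∧
        Unsplittable src tgt D g ∧
        CongLE (capBase c) (∅ : Finset (Sym2 V)) g lam) := by
  refine ⟨isMatching_pairing V, ?_, ?_⟩
  · rintro ⟨f, hf, hu, -, hc⟩
    exact ⟨_, isFlow_restrictFlow hf, unsplittable_restrictFlow hDdiag hf hu,
      congLE_restrictFlow hf.nonneg hc⟩
  · rintro ⟨g, hg, hu, hc⟩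
    exact ⟨liftFlow g α, isFlow_liftFlow hα.le hg, unsplittable_liftFlow hg hu,
      segregated_liftFlow D α g, congLE_liftFlow hα.le hlam hc⟩

end MCRN
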